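/- Recurrence from N to N−2 sites: for every N ≥ 3 and all nonzero complex w₁,w₃,w₄,…,w_N such that both sides are defined (i.e. q w'_j/w'_k ∉ {1,−1} for all j < k in the tuple (w₁, q⁻¹w₁, w₃,…,w_N) and in the tuple (w₃,…,w_N)), |Ψ̃(w₁, q⁻¹w₁, w₃,…,w_N)⟩ = (−1)^N [q] (∏_{j=3}^N [q w₁/w_j][q² w_j/w₁]) |s⟩ ⊗ |Ψ̃(w₃,…,w_N)⟩, where |s⟩ = |⇑⇓⟩ + |⇓⇑⟩ − |00⟩ occupies the first two tensor factors. -/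

import Mathlib

open Matrix BigOperators Finset

noncomputable section

/-- `[z] = z - z⁻¹`. -/
def br (z : ℂ) : ℂ := z - z⁻¹

/-- R-matrix `R^{(1,2)}(z)` on ℂ²⊗ℂ³; basis `(ε, σ)` with ε ∈ {0=↑,1=↓}, σ ∈ {0=⇑,1=0,2=⇓}. -/
def R12 (q c z : ℂ) : Matrix (Fin 2 × Fin 3) (Fin 2 × Fin 3) ℂ :=
  Matrix.of fun p p' =>
    if p = (0,0) ∧ p' = (0,0) then br (q^2*z)
    else if p = (0,1) ∧ p' = (0,1) then br (q*z)
    else if p = (0,2) ∧ p' = (0,2) then br z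
    else if p = (1,0) ∧ p' = (1,0) then br z
    else if p = (1,1) ∧ p' = (1,1) then br (q*z)
    else if p = (1,2) ∧ p' = (1,2) then br (q^2*z)
    else if p = (0,1) ∧ p' = (1,0) then c
    else if p = (0,2) ∧ p' = (1,1) then c
    else if p = (1,0) ∧ p' = (0,1) then c
    else if p = (1,1) ∧ p' = (0,2) then c
    else 0

/-- `R^{(1,2)}` acting on the auxiliary ℂ² and the j-th site of `(ℂ³)^{⊗N}`. -/
def R12at (q c z : ℂ) {N : ℕ} (j : Fin N) :
    Matrix (Fin 2 × (Fin N → Fin 3)) (Fin 2 × (Fin N → Fin 3)) ℂ :=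
  Matrix.of fun p p' =>
    R12 q c z (p.1, p.2 j) (p'.1, p'.2 j) *
      if ∀ k, k ≠ j → p.2 k = p'.2 k then 1 else 0

/-- Monodromy matrix `𝒯_a(z) = R^{(1,2)}_{a,N}(q⁻¹z/w_N) ⋯ R^{(1,2)}_{a,1}(q⁻¹z/w₁)`. -/
def monodromy (q c : ℂ) {N : ℕ} (w : Fin N → ℂ) (z : ℂ) :
    Matrix (Fin 2 × (Fin N → Fin 3)) (Fin 2 × (Fin N → Fin 3)) ℂ :=
  (((List.finRange N).reverse).map fun j => R12at q c (q⁻¹ * z / w j) j).prod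

/-- The operator 𝒜(z): auxiliary block (↑,↑) of the monodromy matrix. -/
def Aop (q c : ℂ) {N : ℕ} (w : Fin N → ℂ) (z : ℂ) :
    Matrix (Fin N → Fin 3) (Fin N → Fin 3) ℂ :=
  Matrix.of fun σ τ => monodromy q c w z (0, σ) (0, τ)

/-- The operator ℬ(z): auxiliary block (↑,↓) of the monodromy matrix. -/
def Bop (q c : ℂ) {N : ℕ} (w : Fin N → ℂ) (z : ℂ) :
    Matrix (Fin N → Fin 3) (Fin N → Fin 3) ℂ :=
  Matrix.of fun σ τ => monodromy q c w z (0, σ) (1, τ)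

/-- The operator 𝒟(z): auxiliary block (↓,↓) of the monodromy matrix. -/
def Dop (q c : ℂ) {N : ℕ} (w : Fin N → ℂ) (z : ℂ) :
    Matrix (Fin N → Fin 3) (Fin N → Fin 3) ℂ :=
  Matrix.of fun σ τ => monodromy q c w z (1, σ) (1, τ)

/-- Bethe reference state `|∧⟩ = |⇑…⇑⟩`. -/
def vac (N : ℕ) : (Fin N → Fin 3) → ℂ := fun σ => if σ = fun _ => 0 then 1 else 0

/-- Bethe vector `|Ψ(w₁,…,w_N)⟩ = ℬ(w₁)⋯ℬ(w_N)|∧⟩`. -/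
def bethe (q c : ℂ) {N : ℕ} (w : Fin N → ℂ) : (Fin N → Fin 3) → ℂ :=
  (((List.finRange N).map fun j => Bop q c w (w j)).prod).mulVec (vac N)

/-- Renormalised Bethe vector
`|Ψ̃(w₁,…,w_N)⟩ = c^{−N} (∏_{j<k} [q w_j/w_k])⁻¹ |Ψ(w₁,…,w_N)⟩`. -/
def betheTilde (q c : ℂ) {N : ℕ} (w : Fin N → ℂ) : (Fin N → Fin 3) → ℂ :=
  ((c ^ N)⁻¹ *
    (∏ pr ∈ Finset.univ.filter (fun pr : Fin N × Fin N => pr.1 < pr.2),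
      br (q * w pr.1 / w pr.2))⁻¹) • bethe q c w

/-- The vector `|s⟩ = |⇑⇓⟩ + |⇓⇑⟩ − |00⟩` in ℂ³⊗ℂ³. -/
def svec : Fin 3 × Fin 3 → ℂ := fun p =>
  if p = (0,2) then 1 else if p = (2,0) then 1 else if p = (1,1) then -1 else 0

open scoped Kronecker

/-- The `(a, b)` auxiliary block of `R12`, an operator on one site. -/
def lax (q c x : ℂ) (a b : Fin 2) : Matrix (Fin 3) (Fin 3) ℂ :=
  Matrix.of fun s t => R12 q c x (a, s) (b, t)

/-- The `(a, b)` auxiliary block of the monodromy matrix. -/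
def monoBlock (q c : ℂ) {N : ℕ} (w : Fin N → ℂ) (z : ℂ) (a b : Fin 2) :
    Matrix (Fin N → Fin 3) (Fin N → Fin 3) ℂ :=
  Matrix.of fun σ τ => monodromy q c w z (a, σ) (b, τ)

/-- The extension of an operator by the identity on an additional first site. -/
def liftSite {n : ℕ} (M : Matrix (Fin 2 × (Fin n → Fin 3)) (Fin 2 × (Fin n → Fin 3)) ℂ) :
    Matrix (Fin 2 × (Fin (n + 1) → Fin 3)) (Fin 2 × (Fin (n + 1) → Fin 3)) ℂ :=
  Matrix.of fun p p' =>
    M (p.1, Fin.tail p.2) (p'.1, Fin.tail p'.2) * if p.2 0 = p'.2 0 then 1 else 0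

lemma sum_cons {n : ℕ} (f : (Fin (n + 1) → Fin 3) → ℂ) :
    ∑ ρ, f ρ = ∑ t : Fin 3, ∑ ρ : Fin n → Fin 3, f (Fin.cons t ρ) := by
  rw [← (Fin.consEquiv (fun _ : Fin (n + 1) => Fin 3)).sum_comp, Fintype.sum_prod_type]
  rfl

lemma liftSite_one {n : ℕ} :
    liftSite (1 : Matrix (Fin 2 × (Fin n → Fin 3)) (Fin 2 × (Fin n → Fin 3)) ℂ) = 1 := by
  ext ⟨a, σ⟩ ⟨b, τ⟩
  have h : σ = τ ↔ σ 0 = τ 0 ∧ Fin.tail σ = Fin.tail τ := by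
    simp only [funext_iff, Fin.forall_fin_succ, Fin.tail]
  simp only [liftSite, Matrix.of_apply, Matrix.one_apply, Prod.mk.injEq, h]
  split_ifs <;> simp_all

lemma liftSite_mul {n : ℕ}
    (M M' : Matrix (Fin 2 × (Fin n → Fin 3)) (Fin 2 × (Fin n → Fin 3)) ℂ) :
    liftSite (M * M') = liftSite M * liftSite M' := by
  ext ⟨a, σ⟩ ⟨b, τ⟩
  simp only [liftSite, Matrix.of_apply, Matrix.mul_apply, Fintype.sum_prod_type, sum_cons,
    Fin.tail_cons, Fin.cons_zero]
  rw [Finset.sum_mul]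
  refine Finset.sum_congr rfl fun e _ => ?_
  rw [Finset.sum_eq_single (σ 0)]
  · simp
  · intro t _ ht
    simp [ht.symm]
  · simp

lemma R12at_succ (q c x : ℂ) {n : ℕ} (j : Fin n) :
    R12at q c x j.succ = liftSite (R12at q c x j) := by
  ext ⟨a, σ⟩ ⟨b, τ⟩
  simp only [R12at, liftSite, Matrix.of_apply, mul_assoc]
  congr 1
  simp only [Fin.forall_fin_succ, Fin.tail, ne_eq, Fin.succ_inj, (Fin.succ_ne_zero j).symm,
    not_false_eq_true, true_imp_iff]
  by_cases h : σ 0 = τ 0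
  · simp only [h, true_and, if_true, mul_one]
    congr
  · simp [h]

lemma monodromy_cons (q c : ℂ) {n : ℕ} (w : ℂ) (v : Fin n → ℂ) (z : ℂ) :
    monodromy q c (Fin.cons w v : Fin (n + 1) → ℂ) z =
      liftSite (monodromy q c v z) * R12at q c (q⁻¹ * z / w) 0 := by
  have h : ∀ l : List (Fin n), (l.map fun j => R12at q c (q⁻¹ * z / v j) j.succ).prod =
      liftSite (l.map fun j => R12at q c (q⁻¹ * z / v j) j).prod := by
    intro l
    induction l with
    | nil => simp [liftSite_one]
    | cons j l ih =>
      rw [List.map_cons, List.prod_cons, ih, List.map_cons, List.prod_cons, liftSite_mul,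
        R12at_succ]
  simp only [monodromy, List.finRange_succ, List.reverse_cons, List.map_append, List.prod_append,
    List.map_cons, List.map_nil, List.prod_singleton, Fin.cons_zero, ← List.map_reverse,
    List.map_map, ← h]
  rfl

lemma monoBlock_cons (q c : ℂ) {n : ℕ} (w : ℂ) (v : Fin n → ℂ) (z : ℂ) (a b : Fin 2) :
    monoBlock q c (Fin.cons w v : Fin (n + 1) → ℂ) z a b =
      (∑ e, lax q c (q⁻¹ * z / w) e b ⊗ₖ monoBlock q c v z a e).submatrix
        (Fin.consEquiv fun _ => Fin 3).symm (Fin.consEquiv fun _ => Fin 3).symm := by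
  ext σ τ
  simp only [monoBlock, Matrix.of_apply, monodromy_cons, Matrix.mul_apply, Fintype.sum_prod_type,
    sum_cons, Matrix.submatrix_apply, Matrix.sum_apply, Matrix.kroneckerMap_apply, lax]
  refine Finset.sum_congr rfl fun e _ => ?_
  rw [Finset.sum_eq_single (σ 0), Finset.sum_eq_single (Fin.tail τ)]
  · simp [liftSite, R12at, Fin.consEquiv, Fin.forall_fin_succ, Fin.tail, mul_comm]
  · intro ρ _ hρ
    have : ¬ ∀ k : Fin n, ρ k = τ k.succ := fun h => hρ (funext h)
    simp [R12at, Fin.forall_fin_succ, this]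
  · simp
  · intro t _ ht
    simp [liftSite, ht.symm]
  · simp

/-- The six-vertex `R`-matrix intertwining two auxiliary spaces. -/
def R11 (q t : ℂ) (a b e f : Fin 2) : ℂ :=
  if a = e ∧ b = f then (if a = b then br (q * t) else br t)
  else if a = f ∧ b = e then br q else 0

/-- The exchange relation `R T₁ T₂ = T₂ T₁ R` in components. -/
def Exchange {m : Type*} [Fintype m] (r : Fin 2 → Fin 2 → Fin 2 → Fin 2 → ℂ)
    (T S : Fin 2 → Fin 2 → Matrix m m ℂ) : Prop :=
  ∀ a b a' b', ∑ e, ∑ f, r a b e f • (T e a' * S f b') =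
    ∑ e, ∑ f, r e f a' b' • (S b f * T a e)

lemma Exchange.kronecker {m m' : Type*} [Fintype m] [Fintype m']
    {r : Fin 2 → Fin 2 → Fin 2 → Fin 2 → ℂ}
    {L L' : Fin 2 → Fin 2 → Matrix m m ℂ} {T S : Fin 2 → Fin 2 → Matrix m' m' ℂ}
    (hL : Exchange r L L') (hT : Exchange r T S) :
    Exchange r (fun a b => ∑ e, L e b ⊗ₖ T a e) (fun a b => ∑ e, L' e b ⊗ₖ S a e) := by
  intro a b a' b'
  ext ⟨i, k⟩ ⟨j, l⟩
  have hL' := fun a b => congrFun (congrFun (hL a b a' b') i) j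
  have hT' := fun a' b' => congrFun (congrFun (hT a b a' b') k) l
  simp only [Matrix.add_apply, Matrix.add_mul, Matrix.mul_add, ← Matrix.mul_kronecker_mul,
    Matrix.smul_apply, Matrix.kroneckerMap_apply, smul_eq_mul, Fin.sum_univ_two] at hL' hT' ⊢
  linear_combination
    (L 0 a' * L' 0 b') i j * hT' 0 0 + (L 0 a' * L' 1 b') i j * hT' 0 1 +
    (L 1 a' * L' 0 b') i j * hT' 1 0 + (L 1 a' * L' 1 b') i j * hT' 1 1 +
    (S b 0 * T a 0) k l * hL' 0 0 + (S b 1 * T a 0) k l * hL' 0 1 +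
    (S b 0 * T a 1) k l * hL' 1 0 + (S b 1 * T a 1) k l * hL' 1 1

lemma Exchange.submatrix {m m' : Type*} [Fintype m] [Fintype m']
    {r : Fin 2 → Fin 2 → Fin 2 → Fin 2 → ℂ} {T S : Fin 2 → Fin 2 → Matrix m m ℂ}
    (h : Exchange r T S) (φ : m' ≃ m) :
    Exchange r (fun a b => (T a b).submatrix φ φ) (fun a b => (S a b).submatrix φ φ) := by
  intro a b a' b'
  ext i j
  have := congrFun (congrFun (h a b a' b') (φ i)) (φ j)
  simpa only [Matrix.submatrix_mul_equiv, Matrix.sum_apply, Matrix.smul_apply,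
    Matrix.submatrix_apply] using this

lemma lax_zero_zero (q c x : ℂ) :
    lax q c x 0 0 = !![br (q ^ 2 * x), 0, 0; 0, br (q * x), 0; 0, 0, br x] := by
  ext i j
  fin_cases i <;> fin_cases j <;> simp [lax, R12]

lemma lax_zero_one (q c x : ℂ) : lax q c x 0 1 = !![0, 0, 0; c, 0, 0; 0, c, 0] := by
  ext i j
  fin_cases i <;> fin_cases j <;> simp [lax, R12]

lemma lax_one_zero (q c x : ℂ) : lax q c x 1 0 = !![0, c, 0; 0, 0, c; 0, 0, 0] := by
  ext i j
  fin_cases i <;> fin_cases j <;> simp [lax, R12]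

lemma lax_one_one (q c x : ℂ) :
    lax q c x 1 1 = !![br x, 0, 0; 0, br (q * x), 0; 0, 0, br (q ^ 2 * x)] := by
  ext i j
  fin_cases i <;> fin_cases j <;> simp [lax, R12]

set_option maxHeartbeats 4000000 in
lemma exchange_lax {q c x y : ℂ} (hq : q ≠ 0) (hc : c ^ 2 = br q * br (q ^ 2)) (hx : x ≠ 0)
    (hy : y ≠ 0) : Exchange (R11 q (x / y)) (lax q c x) (lax q c y) := by
  intro a b a' b'
  ext i j
  fin_cases a <;> fin_cases b <;> fin_cases a' <;> fin_cases b' <;>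
    simp only [Fin.sum_univ_two, Fin.zero_eta, Fin.mk_one, lax_zero_zero, lax_zero_one,
      lax_one_zero, lax_one_one] <;>
    fin_cases i <;> fin_cases j <;>
    simp [R11, -mul_eq_mul_left_iff, -mul_eq_mul_right_iff] <;>
    first
    | ring1
    | linear_combination (norm := (simp only [br]; field_simp; ring1)) (0 : ℂ) * hc
    | linear_combination (norm := (simp only [br]; field_simp; ring1)) br (x / y) * hc
    | linear_combination (norm := (simp only [br]; field_simp; ring1)) -br (x / y) * hc

lemma monodromy_zero (q c : ℂ) (w : Fin 0 → ℂ) (z : ℂ) : monodromy q c w z = 1 := by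
  simp [monodromy]

lemma exchange_monoBlock {q c : ℂ} (hq : q ≠ 0) (hc : c ^ 2 = br q * br (q ^ 2)) {z u : ℂ}
    (hz : z ≠ 0) (hu : u ≠ 0) {n : ℕ} (w : Fin n → ℂ) (hw : ∀ i, w i ≠ 0) :
    Exchange (R11 q (z / u)) (monoBlock q c w z) (monoBlock q c w u) := by
  induction n with
  | zero =>
    have h (x : ℂ) (a b : Fin 2) :
        monoBlock q c w x a b = (if a = b then (1 : ℂ) else 0) • 1 := by
      ext σ τ
      simp [monoBlock, monodromy_zero, Matrix.one_apply, Subsingleton.elim σ τ]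
    intro a b a' b'
    simp only [h, Fin.sum_univ_two]
    fin_cases a <;> fin_cases b <;> fin_cases a' <;> fin_cases b' <;> simp [R11]
  | succ n ih =>
    induction w using Fin.consCases with
    | _ w v =>
    have hw0 : w ≠ 0 := hw 0
    have hL := exchange_lax hq hc (x := q⁻¹ * z / w) (y := q⁻¹ * u / w) (by positivity)
      (by positivity)
    rw [show q⁻¹ * z / w / (q⁻¹ * u / w) = z / u by field_simp] at hL
    have := (hL.kronecker (ih v fun i => hw i.succ)).submatrix
      (Fin.consEquiv fun _ : Fin (n + 1) => Fin 3).symm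
    simpa only [← monoBlock_cons] using this

lemma br_inv (z : ℂ) : br z⁻¹ = -br z := by
  simp [br]

lemma br_ne_zero {z : ℂ} (hz : z ≠ 0) (h : z ≠ 1 ∧ z ≠ -1) : br z ≠ 0 := by
  intro h0
  have h2 : z * z = 1 := by
    rw [br, sub_eq_zero] at h0
    nth_rewrite 2 [h0]
    exact mul_inv_cancel₀ hz
  rcases mul_self_eq_one_iff.mp h2 with h' | h'
  exacts [h.1 h', h.2 h']

lemma Bop_eq_monoBlock (q c : ℂ) {n : ℕ} (w : Fin n → ℂ) (z : ℂ) :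
    Bop q c w z = monoBlock q c w z 0 1 := rfl

lemma Aop_eq_monoBlock (q c : ℂ) {n : ℕ} (w : Fin n → ℂ) (z : ℂ) :
    Aop q c w z = monoBlock q c w z 0 0 := rfl

lemma br_mul_div_ne_zero_or {q z u : ℂ} (hq : q ≠ 0) (hq4 : q ^ 4 ≠ 1) (hz : z ≠ 0)
    (hu : u ≠ 0) : br (q * (z / u)) ≠ 0 ∨ br (q * (u / z)) ≠ 0 := by
  by_contra! h
  obtain ⟨h1, h2⟩ := h
  simp only [br] at h1 h2
  field_simp at h1 h2
  refine hq4 (mul_right_cancel₀ (pow_ne_zero 2 hz) ?_)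
  linear_combination q ^ 2 * h1 + h2

/-- The operators `ℬ(z)` commute. -/
lemma Bop_commute {q c : ℂ} (hq : q ≠ 0) (hq4 : q ^ 4 ≠ 1) (hc : c ^ 2 = br q * br (q ^ 2))
    {n : ℕ} (w : Fin n → ℂ) (hw : ∀ i, w i ≠ 0) {z u : ℂ} (hz : z ≠ 0) (hu : u ≠ 0) :
    Commute (Bop q c w z) (Bop q c w u) := by
  simp only [commute_iff_eq, Bop_eq_monoBlock]
  rcases br_mul_div_ne_zero_or hq hq4 hz hu with h | h
  · have := exchange_monoBlock hq hc hz hu w hw 0 0 1 1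
    simpa [R11, h, Fin.sum_univ_two] using this
  · have := exchange_monoBlock hq hc hu hz w hw 0 0 1 1
    simpa [R11, h, Fin.sum_univ_two] using this.symm

lemma Aop_mul_Bop {q c : ℂ} (hq : q ≠ 0) (hc : c ^ 2 = br q * br (q ^ 2)) (hbq : br q ≠ 0)
    {n : ℕ} (w : Fin n → ℂ) (hw : ∀ i, w i ≠ 0) {z : ℂ} (hz : z ≠ 0) :
    Aop q c w z * Bop q c w (q⁻¹ * z) = Bop q c w z * Aop q c w (q⁻¹ * z) := by
  have h := exchange_monoBlock hq hc (mul_ne_zero (inv_ne_zero hq) hz) hz w hw 0 0 0 1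
  have h1 : br (q * q⁻¹) = 0 := by
    simp [br, hq]
  have h2 : q⁻¹ * z / z = q⁻¹ := by field_simp
  simp only [Aop_eq_monoBlock, Bop_eq_monoBlock]
  simp only [R11, Fin.sum_univ_two, h2, h1, br_inv] at h
  refine smul_right_injective _ hbq ?_
  simp at h
  exact sub_eq_zero.mp (by rw [sub_eq_neg_add]; exact h.symm)

lemma monoBlock_cons_mulVec (q c : ℂ) {n : ℕ} (w : ℂ) (v : Fin n → ℂ) (z : ℂ) (a b : Fin 2)
    (ψ : (Fin (n + 1) → Fin 3) → ℂ) (σ : Fin (n + 1) → Fin 3) :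
    (monoBlock q c (Fin.cons w v : Fin (n + 1) → ℂ) z a b *ᵥ ψ) σ =
      ∑ e, ∑ t, lax q c (q⁻¹ * z / w) e b (σ 0) t *
        (monoBlock q c v z a e *ᵥ fun ρ => ψ (Fin.cons t ρ)) (Fin.tail σ) := by
  simp only [monoBlock_cons, Matrix.mulVec, dotProduct, sum_cons, Matrix.submatrix_apply,
    Matrix.sum_apply, Finset.sum_mul, Finset.mul_sum, Matrix.kroneckerMap_apply]
  rw [Finset.sum_comm (s := (Finset.univ : Finset (Fin 2)))]
  refine Finset.sum_congr rfl fun t _ => ?_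
  rw [Finset.sum_comm]
  exact Finset.sum_congr rfl fun e _ => Finset.sum_congr rfl fun ρ _ => mul_assoc _ _ _

/-- The vector `u ⊗ φ`, with `u` on the first two sites. -/
def tens {n : ℕ} (u : Matrix (Fin 3) (Fin 3) ℂ) (φ : (Fin n → Fin 3) → ℂ) :
    (Fin (n + 2) → Fin 3) → ℂ :=
  fun σ => u (σ 0) (σ 1) * φ fun i => σ i.succ.succ

lemma tens_smul {n : ℕ} (u : Matrix (Fin 3) (Fin 3) ℂ) (r : ℂ) (φ : (Fin n → Fin 3) → ℂ) :
    tens u (r • φ) = r • tens u φ := by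
  ext σ
  simp only [tens, Pi.smul_apply, smul_eq_mul]
  ring

lemma smul_tens {n : ℕ} (u : Matrix (Fin 3) (Fin 3) ℂ) (r : ℂ) (φ : (Fin n → Fin 3) → ℂ) :
    tens (r • u) φ = r • tens u φ := by
  ext σ
  simp only [tens, Pi.smul_apply, Matrix.smul_apply, smul_eq_mul]
  ring

lemma zero_tens {n : ℕ} (φ : (Fin n → Fin 3) → ℂ) : tens 0 φ = 0 := by
  ext σ
  simp [tens]

/-- The action of the two-site monodromy block `(e, b)` on a vector of `ℂ³ ⊗ ℂ³`. -/
def laxPair (q c x y : ℂ) (e b : Fin 2) (u : Matrix (Fin 3) (Fin 3) ℂ) :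
    Matrix (Fin 3) (Fin 3) ℂ :=
  lax q c x 0 b * u * (lax q c y e 0)ᵀ + lax q c x 1 b * u * (lax q c y e 1)ᵀ

lemma Bop_mulVec_tens (q c : ℂ) {n : ℕ} (w₁ w₂ : ℂ) (v : Fin n → ℂ) (z : ℂ)
    (u : Matrix (Fin 3) (Fin 3) ℂ) (φ : (Fin n → Fin 3) → ℂ) :
    Bop q c (Fin.cons w₁ (Fin.cons w₂ v) : Fin (n + 2) → ℂ) z *ᵥ tens u φ =
      tens (laxPair q c (q⁻¹ * z / w₁) (q⁻¹ * z / w₂) 0 1 u) (Aop q c v z *ᵥ φ) +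
      tens (laxPair q c (q⁻¹ * z / w₁) (q⁻¹ * z / w₂) 1 1 u) (Bop q c v z *ᵥ φ) := by
  ext σ
  have h (M : Matrix (Fin n → Fin 3) (Fin n → Fin 3) ℂ) (s t : Fin 3) :
      (M *ᵥ fun ρ => tens u φ (Fin.cons s (Fin.cons t ρ))) = u s t • (M *ᵥ φ) := by
    rw [← Matrix.mulVec_smul]
    rfl
  have hσ : Fin.tail (Fin.tail σ) = fun i => σ i.succ.succ := rfl
  have hσ1 : Fin.tail σ 0 = σ 1 := rfl
  simp only [Bop_eq_monoBlock, Aop_eq_monoBlock, monoBlock_cons_mulVec, h, hσ, hσ1, Pi.add_apply]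
  simp only [tens, laxPair, Matrix.add_apply, Matrix.mul_apply, Matrix.transpose_apply,
    Pi.smul_apply, smul_eq_mul, Fin.sum_univ_two, Fin.sum_univ_three]
  ring

lemma vac_cons {n : ℕ} (t : Fin 3) (ρ : Fin n → Fin 3) :
    vac (n + 1) (Fin.cons t ρ) = (if t = 0 then 1 else 0) * vac n ρ := by
  simp only [vac, funext_iff, Fin.forall_fin_succ, Fin.cons_zero, Fin.cons_succ]
  split_ifs <;> simp_all

lemma vac_eq_tens (n : ℕ) : vac (n + 2) = tens !![1, 0, 0; 0, 0, 0; 0, 0, 0] (vac n) := by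
  ext σ
  rw [← Fin.cons_self_tail σ, ← Fin.cons_self_tail (Fin.tail σ), vac_cons, vac_cons]
  generalize σ 0 = s
  generalize Fin.tail σ 0 = t
  generalize Fin.tail (Fin.tail σ) = ρ
  change _ = (!![1, 0, 0; 0, 0, 0; 0, 0, 0] : Matrix (Fin 3) (Fin 3) ℂ) s t * vac n ρ
  fin_cases s <;> fin_cases t <;> simp

lemma Aop_mulVec_vac (q c : ℂ) (hq : q ≠ 0) {n : ℕ} (v : Fin n → ℂ) (z : ℂ) :
    Aop q c v z *ᵥ vac n = (∏ i, br (q * z / v i)) • vac n := by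
  rw [Aop_eq_monoBlock]
  induction n with
  | zero =>
    ext σ
    simp [monoBlock, monodromy_zero, Matrix.mulVec, dotProduct,
      Subsingleton.elim _ σ]
  | succ n ih =>
    induction v using Fin.consCases with
    | _ w v =>
    ext σ
    have h (M : Matrix (Fin n → Fin 3) (Fin n → Fin 3) ℂ) (t : Fin 3) :
        (M *ᵥ fun ρ => vac (n + 1) (Fin.cons t ρ)) =
          (if t = 0 then (1 : ℂ) else 0) • (M *ᵥ vac n) := by
      rw [← Matrix.mulVec_smul]
      simp only [vac_cons]
      rfl
    rw [monoBlock_cons_mulVec]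
    have hσ := vac_cons (σ 0) (Fin.tail σ)
    rw [Fin.cons_self_tail] at hσ
    simp only [h, Fin.sum_univ_two, ih, hσ, Fin.prod_univ_succ, Fin.cons_zero, Fin.cons_succ,
      Pi.smul_apply, smul_eq_mul, Fin.sum_univ_three, lax_zero_zero, lax_one_zero]
    have hx : q ^ 2 * (q⁻¹ * z / w) = q * z / w := by field_simp
    generalize σ 0 = s
    fin_cases s <;> simp [hx, mul_assoc]

/-- The two-site singlet as a matrix. -/
def singlet : Matrix (Fin 3) (Fin 3) ℂ := !![0, 0, 1; 0, -1, 0; 1, 0, 0]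

lemma svec_eq_singlet (s t : Fin 3) : svec (s, t) = singlet s t := by
  fin_cases s <;> fin_cases t <;> simp [svec, singlet]

lemma laxPair_zero_singlet (q c x : ℂ) : laxPair q c x (q * x) 0 1 singlet = 0 := by
  ext i j
  simp only [laxPair, Matrix.add_apply, Matrix.mul_apply, Matrix.transpose_apply,
    Fin.sum_univ_three, lax_zero_zero, lax_zero_one, lax_one_one, singlet]
  fin_cases i <;> fin_cases j <;> simp <;> ring_nf

lemma laxPair_one_singlet {q c x : ℂ} (hq : q ≠ 0) (hc : c ^ 2 = br q * br (q ^ 2))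
    (hx : x ≠ 0) :
    laxPair q c x (q * x) 1 1 singlet = (br x * br (q ^ 3 * x)) • singlet := by
  ext i j
  simp only [laxPair, Matrix.add_apply, Matrix.mul_apply, Matrix.transpose_apply,
    Fin.sum_univ_three, lax_zero_one, lax_one_zero, lax_one_one, singlet]
  fin_cases i <;> fin_cases j <;>
    simp [-mul_eq_mul_left_iff, -mul_eq_mul_right_iff] <;>
  first
  | ring1
  | linear_combination (norm := (simp only [br]; field_simp; ring1)) (0 : ℂ) * hc
  | linear_combination (norm := (simp only [br]; field_simp; ring1)) hc
  | linear_combination (norm := (simp only [br]; field_simp; ring1)) -hc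

lemma Bop_mulVec_singlet {q c : ℂ} (hq : q ≠ 0) (hc : c ^ 2 = br q * br (q ^ 2)) {n : ℕ}
    {w z : ℂ} (hw : w ≠ 0) (hz : z ≠ 0) (v : Fin n → ℂ) (φ : (Fin n → Fin 3) → ℂ) :
    Bop q c (Fin.cons w (Fin.cons (q⁻¹ * w) v) : Fin (n + 2) → ℂ) z *ᵥ tens singlet φ =
      -(br (q * w / z) * br (q ^ 2 * z / w)) • tens singlet (Bop q c v z *ᵥ φ) := by
  have hx : q⁻¹ * z / (q⁻¹ * w) = q * (q⁻¹ * z / w) := by field_simp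
  have hx1 : br (q⁻¹ * z / w) = -br (q * w / z) := by
    rw [← br_inv]
    congr 1
    field_simp
  have hx2 : q ^ 3 * (q⁻¹ * z / w) = q ^ 2 * z / w := by field_simp
  rw [Bop_mulVec_tens, hx, laxPair_zero_singlet, laxPair_one_singlet hq hc (by positivity),
    zero_tens, zero_add, smul_tens, hx1, hx2, neg_mul]

lemma Bop_mul_Bop_mulVec_vac {q c : ℂ} (hq : q ≠ 0) (hc : c ^ 2 = br q * br (q ^ 2))
    (hbq : br q ≠ 0) {n : ℕ} {w : ℂ} (hw : w ≠ 0) (v : Fin n → ℂ) (hv : ∀ i, v i ≠ 0) :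
    Bop q c (Fin.cons w (Fin.cons (q⁻¹ * w) v) : Fin (n + 2) → ℂ) w *ᵥ
      (Bop q c (Fin.cons w (Fin.cons (q⁻¹ * w) v) : Fin (n + 2) → ℂ) (q⁻¹ * w) *ᵥ vac (n + 2)) =
      (c ^ 2 * (br q * br (q ^ 2)) * ∏ i, br (q * w / v i) * br (w / v i)) •
        tens singlet (vac n) := by
  have hb1 : br 1 = 0 := by simp [br]
  have hx1 : q⁻¹ * (q⁻¹ * w) / w = (q ^ 2)⁻¹ := by field_simp
  have hx2 : q⁻¹ * (q⁻¹ * w) / (q⁻¹ * w) = q⁻¹ := by field_simp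
  have hx3 : q⁻¹ * w / w = q⁻¹ := by field_simp
  have hx4 : q⁻¹ * w / (q⁻¹ * w) = 1 := by field_simp
  have e2 : q ^ 2 * q⁻¹ = q := by field_simp
  have u0 : laxPair q c (q ^ 2)⁻¹ q⁻¹ 0 1 !![1, 0, 0; 0, 0, 0; 0, 0, 0] =
      c • !![0, -br (q ^ 2), 0; br q, 0, 0; 0, 0, 0] := by
    ext i j
    simp only [laxPair, Matrix.add_apply, Matrix.mul_apply, Matrix.transpose_apply,
      Fin.sum_univ_three, lax_zero_zero, lax_zero_one, lax_one_one]
    fin_cases i <;> fin_cases j <;> simp [br_inv, e2, mul_comm]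
  have u1 : laxPair q c (q ^ 2)⁻¹ q⁻¹ 1 1 !![1, 0, 0; 0, 0, 0; 0, 0, 0] =
      (br q * br (q ^ 2)) • !![1, 0, 0; 0, 0, 0; 0, 0, 0] := by
    ext i j
    simp only [laxPair, Matrix.add_apply, Matrix.mul_apply, Matrix.transpose_apply,
      Fin.sum_univ_three, lax_zero_one, lax_one_zero, lax_one_one]
    fin_cases i <;> fin_cases j <;> simp [br_inv, mul_comm]
  have u00 : laxPair q c q⁻¹ 1 0 1 (c • !![0, -br (q ^ 2), 0; br q, 0, 0; 0, 0, 0]) =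
      (c ^ 2 * (br q * br (q ^ 2))) • singlet := by
    ext i j
    simp only [laxPair, Matrix.add_apply, Matrix.mul_apply, Matrix.transpose_apply,
      Fin.sum_univ_three, lax_zero_zero, lax_zero_one, lax_one_one, singlet]
    fin_cases i <;> fin_cases j <;>
      simp [br_inv, e2, hb1, hq, -mul_eq_mul_left_iff, -mul_eq_mul_right_iff] <;>
      ring1
  have u01 : laxPair q c q⁻¹ 1 1 1 (c • !![0, -br (q ^ 2), 0; br q, 0, 0; 0, 0, 0]) =
      (c * (br q * br (q ^ 2))) • !![0, br q, 0; -br (q ^ 2), 0, 0; 0, 0, 0] := by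
    ext i j
    simp only [laxPair, Matrix.add_apply, Matrix.mul_apply, Matrix.transpose_apply,
      Fin.sum_univ_three, lax_zero_one, lax_one_zero, lax_one_one]
    fin_cases i <;> fin_cases j <;>
      simp [br_inv, e2, hb1, hq, -mul_eq_mul_left_iff, -mul_eq_mul_right_iff] <;>
      first | ring1 | linear_combination c * br (q ^ 2) * hc
  have u10 : laxPair q c q⁻¹ 1 0 1 ((br q * br (q ^ 2)) • !![1, 0, 0; 0, 0, 0; 0, 0, 0]) =
      (-(c * (br q * br (q ^ 2)))) • !![0, br q, 0; -br (q ^ 2), 0, 0; 0, 0, 0] := by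
    ext i j
    simp only [laxPair, Matrix.add_apply, Matrix.mul_apply, Matrix.transpose_apply,
      Fin.sum_univ_three, lax_zero_zero, lax_zero_one, lax_one_one]
    fin_cases i <;> fin_cases j <;>
      simp [br_inv, e2, hb1, hq, -mul_eq_mul_left_iff, -mul_eq_mul_right_iff] <;>
      ring1
  have u11 : laxPair q c q⁻¹ 1 1 1 ((br q * br (q ^ 2)) • !![1, 0, 0; 0, 0, 0; 0, 0, 0]) = 0 := by
    ext i j
    simp only [laxPair, Matrix.add_apply, Matrix.mul_apply, Matrix.transpose_apply,
      Fin.sum_univ_three, lax_zero_one, lax_one_zero, lax_one_one]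
    fin_cases i <;> fin_cases j <;> simp [br_inv, hb1]
  have hA : Aop q c v w *ᵥ (Aop q c v (q⁻¹ * w) *ᵥ vac n) =
      (∏ i, br (q * w / v i) * br (w / v i)) • vac n := by
    have (i : Fin n) : q * (q⁻¹ * w) / v i = w / v i := by field_simp
    simp only [Aop_mulVec_vac q c hq, Matrix.mulVec_smul, smul_smul, Finset.prod_mul_distrib, this]
    rw [mul_comm]
  have hAB : Aop q c v w *ᵥ (Bop q c v (q⁻¹ * w) *ᵥ vac n) =
      Bop q c v w *ᵥ (Aop q c v (q⁻¹ * w) *ᵥ vac n) := by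
    rw [Matrix.mulVec_mulVec, Matrix.mulVec_mulVec, Aop_mul_Bop hq hc hbq v hv hw]
  rw [vac_eq_tens, Bop_mulVec_tens, hx1, hx2, u0, u1, Matrix.mulVec_add, Bop_mulVec_tens,
    Bop_mulVec_tens, hx3, hx4, u00, u01, u10, u11, hAB, hA, zero_tens, tens_smul]
  simp only [smul_tens]
  module

lemma prod_filter_lt_cons_cons {n : ℕ} (f : ℂ → ℂ → ℂ) (x y : ℂ) (v : Fin n → ℂ) :
    ∏ pr ∈ Finset.univ.filter (fun pr : Fin (n + 2) × Fin (n + 2) => pr.1 < pr.2),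
        f ((Fin.cons x (Fin.cons y v) : Fin (n + 2) → ℂ) pr.1)
          ((Fin.cons x (Fin.cons y v) : Fin (n + 2) → ℂ) pr.2) =
      f x y * (∏ i, f x (v i) * f y (v i)) *
        ∏ pr ∈ Finset.univ.filter (fun pr : Fin n × Fin n => pr.1 < pr.2),
          f (v pr.1) (v pr.2) := by
  simp only [Finset.prod_filter, Fintype.prod_prod_type, Fin.prod_univ_succ, Fin.cons_zero,
    Fin.cons_succ, Finset.prod_mul_distrib, Fin.succ_lt_succ_iff, Fin.succ_pos, Fin.not_lt_zero,
    if_true, if_false, Finset.prod_const_one, one_mul, mul_assoc]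

/-- Recurrence from N to N−2 sites: if `w₂ = q⁻¹w₁` then
`|Ψ̃(w₁,q⁻¹w₁,w₃,…,w_N)⟩ = (−1)^N [q] (∏_{j≥3}[q w₁/w_j][q² w_j/w₁]) |s⟩⊗|Ψ̃(w₃,…,w_N)⟩`. -/
theorem stmt13 (q c : ℂ) (hq : q ≠ 0) (hq4 : q^4 ≠ 1) (hc : c^2 = br q * br (q^2))
    (n : ℕ) (hn : 1 ≤ n) (w1 : ℂ) (hw1 : w1 ≠ 0)
    (v : Fin n → ℂ) (hv : ∀ i, v i ≠ 0)
    (hgenW : ∀ j k : Fin (n+2), j < k →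
      q * (Fin.cons w1 (Fin.cons (q⁻¹ * w1) v) : Fin (n+2) → ℂ) j /
          (Fin.cons w1 (Fin.cons (q⁻¹ * w1) v) : Fin (n+2) → ℂ) k ≠ 1 ∧
        q * (Fin.cons w1 (Fin.cons (q⁻¹ * w1) v) : Fin (n+2) → ℂ) j /
          (Fin.cons w1 (Fin.cons (q⁻¹ * w1) v) : Fin (n+2) → ℂ) k ≠ -1)
    (hgenV : ∀ j k : Fin n, j < k → q * v j / v k ≠ 1 ∧ q * v j / v k ≠ -1) :
    betheTilde q c (Fin.cons w1 (Fin.cons (q⁻¹ * w1) v)) =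
      ((-1 : ℂ)^(n+2) * br q * ∏ i, br (q * w1 / v i) * br (q^2 * v i / w1)) •
        (fun σ : Fin (n+2) → Fin 3 =>
          svec (σ 0, σ 1) * betheTilde q c v (fun i => σ i.succ.succ)) := by
  set W : Fin (n + 2) → ℂ := Fin.cons w1 (Fin.cons (q⁻¹ * w1) v) with hW
  have hW0 : ∀ i, W i ≠ 0 := by
    simp only [hW, Fin.forall_fin_succ, Fin.cons_zero, Fin.cons_succ]
    exact ⟨hw1, by positivity, hv⟩
  have hbq : br q ≠ 0 :=
    br_ne_zero hq ⟨by rintro rfl; simp at hq4, by rintro rfl; norm_num at hq4⟩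
  have hbq2 : br (q ^ 2) ≠ 0 := by
    refine br_ne_zero (by positivity) ⟨fun h => hq4 ?_, fun h => hq4 ?_⟩ <;>
      rw [show q ^ 4 = (q ^ 2) ^ 2 by ring, h] <;> norm_num
  have hc0 : c ≠ 0 := by
    rintro rfl
    exact mul_ne_zero hbq hbq2 (by rw [← hc]; ring)
  have hlist (l : List (Fin n)) (φ : (Fin n → Fin 3) → ℂ) :
      (l.map fun j => Bop q c W (v j)).prod *ᵥ tens singlet φ =
        (l.map fun j => -(br (q * w1 / v j) * br (q ^ 2 * v j / w1))).prod •
          tens singlet ((l.map fun j => Bop q c v (v j)).prod *ᵥ φ) := by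
    induction l with
    | nil => simp
    | cons j l ih =>
      simp only [List.map_cons, List.prod_cons, ← Matrix.mulVec_mulVec]
      rw [ih, Matrix.mulVec_smul, hW, Bop_mulVec_singlet hq hc hw1 (hv j), smul_smul, mul_comm]
  have hcomm : Commute (Bop q c W w1 * Bop q c W (q⁻¹ * w1))
      ((List.finRange n).map fun j => Bop q c W (v j)).prod := by
    refine Commute.list_prod_right _ _ fun M hM => ?_
    obtain ⟨j, -, rfl⟩ := List.mem_map.mp hM
    exact (Bop_commute hq hq4 hc W hW0 hw1 (hv j)).mul_left
      (Bop_commute hq hq4 hc W hW0 (by positivity) (hv j))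
  have hbethe : bethe q c W =
      (c ^ 2 * (br q * br (q ^ 2)) * (∏ i, br (q * w1 / v i) * br (w1 / v i)) *
        ∏ i, -(br (q * w1 / v i) * br (q ^ 2 * v i / w1))) • tens singlet (bethe q c v) := by
    have h : ((List.finRange (n + 2)).map fun j => Bop q c W (W j)).prod =
        Bop q c W w1 * Bop q c W (q⁻¹ * w1) *
          ((List.finRange n).map fun j => Bop q c W (v j)).prod := by
      simp only [List.finRange_succ, List.map_cons, List.map_map, List.prod_cons, mul_assoc]
      rfl
    rw [bethe, h, hcomm.eq, ← Matrix.mulVec_mulVec, ← Matrix.mulVec_mulVec,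
      Bop_mul_Bop_mulVec_vac hq hc hbq hw1 v hv, Matrix.mulVec_smul, hlist, smul_smul,
      ← List.ofFn_eq_map, List.prod_ofFn]
    rfl
  have hx1 (i : Fin n) : br (q * w1 / v i) ≠ 0 :=
    br_ne_zero (div_ne_zero (mul_ne_zero hq hw1) (hv i))
      (by simpa [hW] using hgenW 0 i.succ.succ (Fin.succ_pos _))
  have hx2 (i : Fin n) : br (w1 / v i) ≠ 0 := by
    have h := hgenW 1 i.succ.succ (by simp [Fin.lt_def])
    have hW1 : W 1 = q⁻¹ * w1 := rfl
    have hWi : W i.succ.succ = v i := rfl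
    rw [hW1, hWi, mul_inv_cancel_left₀ hq] at h
    exact br_ne_zero (div_ne_zero hw1 (hv i)) h
  have hP : (∏ i, br (q * w1 / v i) * br (w1 / v i)) ≠ 0 :=
    Finset.prod_ne_zero_iff.mpr fun i _ => mul_ne_zero (hx1 i) (hx2 i)
  have hnorm := prod_filter_lt_cons_cons (fun a b => br (q * a / b)) w1 (q⁻¹ * w1) v
  rw [show q * w1 / (q⁻¹ * w1) = q ^ 2 by field_simp] at hnorm
  simp only [mul_inv_cancel_left₀ hq, ← hW] at hnorm
  have hsign : ∏ i, -(br (q * w1 / v i) * br (q ^ 2 * v i / w1)) =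
      (-1) ^ (n + 2) * ∏ i, br (q * w1 / v i) * br (q ^ 2 * v i / w1) := by
    rw [Finset.prod_neg]
    simp [pow_add]
  ext σ
  simp only [betheTilde, hnorm, hbethe, hsign, Pi.smul_apply, smul_eq_mul, tens, svec_eq_singlet]
  field_simp
  ring

end
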